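/- arXiv:2604.21299 — 2 statements merged into one kernel-verified Lean document; each statement's English description precedes it below -/
import Mathlib

section
/- There exists a constant C > 0 such that for every real p > 4 and every Schwartz function u : ℝ³ → ℝ³, one has ‖Du‖_{L^∞(ℝ³)} ≤ C·( ‖u‖_{L²(ℝ³)} + ‖D²u‖_{L^p(ℝ³)} ), where Du denotes the (first) total derivative of u and D²u denotes the second total derivative of u. The constant C is independent of p (it remains bounded as p → ∞ over p > 4). -/
open MeasureTheory SchwartzMap

section

variable {E F : Type*} [NormedAddCommGroup E] [NormedSpace ℝ E]
  [NormedAddCommGroup F] [NormedSpace ℝ F]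

theorem enorm_sub_apply_zero_le_lintegral_fderiv [CompleteSpace F] {f : E → F}
    (hf : ContDiff ℝ 1 f) (y : E) :
    ‖f y - f 0‖ₑ ≤ ∫⁻ t in Set.Ioc (0 : ℝ) 1, ‖fderiv ℝ f (t • y)‖ₑ * ‖y‖ₑ := by
  have hcont : Continuous fun t : ℝ => fderiv ℝ f (t • y) y :=
    ((hf.continuous_fderiv one_ne_zero).comp (by fun_prop)).clm_apply continuous_const
  have hderiv : ∀ t ∈ Set.uIcc (0 : ℝ) 1,
      HasDerivAt (fun t : ℝ => f (t • y)) (fderiv ℝ f (t • y) y) t := fun t _ => by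
    have h1 : HasDerivAt (fun t : ℝ => t • y) y t := by
      simpa using (hasDerivAt_id t).smul_const y
    exact ((hf.differentiable one_ne_zero) (t • y)).hasFDerivAt.comp_hasDerivAt t h1
  have h := intervalIntegral.integral_eq_sub_of_hasDerivAt hderiv (hcont.intervalIntegrable 0 1)
  simp only [one_smul, zero_smul] at h
  rw [← h, intervalIntegral.integral_of_le zero_le_one]
  exact (enorm_integral_le_lintegral_enorm _).trans
    (lintegral_mono fun t => ContinuousLinearMap.le_opENorm _ _)

variable [FiniteDimensional ℝ E] [MeasurableSpace E] [BorelSpace E]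
  (μ : Measure E) [μ.IsAddHaarMeasure]

theorem eLpNorm_comp_smul {G : Type*} [NormedAddCommGroup G] {g : E → G} (hg : Continuous g)
    (p : ENNReal) {t : ℝ} (ht : 0 < t) :
    eLpNorm (fun y => g (t • y)) p μ
      = ENNReal.ofReal (t ^ (-(Module.finrank ℝ E / p.toReal))) * eLpNorm g p μ := by
  have hne : ENNReal.ofReal |(t ^ Module.finrank ℝ E)⁻¹| ≠ 0 := by
    simp only [ne_eq, ENNReal.ofReal_eq_zero, not_le]
    positivity
  have hmap := eLpNorm_map_measure (p := p) (μ := μ) (f := fun y : E => t • y)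
    hg.aestronglyMeasurable (by fun_prop)
  rw [Measure.map_addHaar_smul μ ht.ne', eLpNorm_smul_measure_of_ne_zero hne] at hmap
  change eLpNorm (g ∘ fun y => t • y) p μ = _
  rw [← hmap, smul_eq_mul, ENNReal.ofReal_rpow_of_pos (by positivity)]
  congr 2
  rw [abs_of_pos (by positivity), ← Real.rpow_natCast, ← Real.rpow_neg ht.le, ← Real.rpow_mul ht.le]
  congr 1
  simp [ENNReal.toReal_inv, div_eq_mul_inv]

theorem setLIntegral_enorm_comp_smul_le {G : Type*} [NormedAddCommGroup G] {g : E → G}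
    (hg : Continuous g) {p : ENNReal} (hp : 1 ≤ p) (s : Set E) {t : ℝ} (ht : 0 < t) :
    ∫⁻ y in s, ‖g (t • y)‖ₑ ∂μ
      ≤ ENNReal.ofReal (t ^ (-(Module.finrank ℝ E / p.toReal))) * eLpNorm g p μ
        * μ s ^ (1 - 1 / p.toReal) := by
  have hgt : Continuous fun y => g (t • y) := by fun_prop
  rw [← eLpNorm_one_eq_lintegral_enorm]
  refine (eLpNorm_le_eLpNorm_mul_rpow_measure_univ hp hgt.aestronglyMeasurable).trans ?_
  rw [← eLpNorm_comp_smul μ hg p ht]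
  simp only [ENNReal.toReal_one, div_one, Measure.restrict_apply_univ]
  gcongr
  exact Measure.restrict_le_self

theorem enorm_integral_smul_fderiv_le [CompleteSpace F] {φ : E → ℝ} (hφ : ContDiff ℝ 1 φ)
    (hφc : HasCompactSupport φ) {u : E → F} (hu : ContDiff ℝ 1 u) :
    ‖∫ y, φ y • fderiv ℝ u y ∂μ‖ₑ ≤ eLpNorm (fderiv ℝ φ) 2 μ * eLpNorm u 2 μ := by
  have hdφ : Continuous (fderiv ℝ φ) := hφ.continuous_fderiv one_ne_zero
  have hdu : Continuous (fderiv ℝ u) := hu.continuous_fderiv one_ne_zero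
  have hφ' : Continuous φ := hφ.continuous
  have hu' : Continuous u := hu.continuous
  refine ContinuousLinearMap.opENorm_le_bound _ fun e => ?_
  have hint : Integrable (fun y => φ y • fderiv ℝ u y) μ :=
    (hφ'.smul hdu).integrable_of_hasCompactSupport hφc.smul_right
  have hdφe : HasCompactSupport fun y => fderiv ℝ φ y e := hφc.fderiv_apply ℝ e
  rw [ContinuousLinearMap.integral_apply hint]
  simp only [smul_apply]
  rw [integral_smul_fderiv_eq_neg_fderiv_smul_of_integrable, enorm_neg]
  · calc ‖∫ y, fderiv ℝ φ y e • u y ∂μ‖ₑ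
        ≤ ∫⁻ y, ‖fderiv ℝ φ y e • u y‖ₑ ∂μ := enorm_integral_le_lintegral_enorm _
      _ ≤ ∫⁻ y, (‖fderiv ℝ φ y‖ₑ * ‖u y‖ₑ) * ‖e‖ₑ ∂μ := by
          refine lintegral_mono fun y => ?_
          rw [enorm_smul, mul_right_comm]
          gcongr
          exact ContinuousLinearMap.le_opENorm _ _
      _ = (∫⁻ y, ‖fderiv ℝ φ y‖ₑ * ‖u y‖ₑ ∂μ) * ‖e‖ₑ :=
          lintegral_mul_const _ (by fun_prop)
      _ ≤ _ := by
          gcongr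
          have h := ENNReal.lintegral_mul_le_Lp_mul_Lq μ Real.HolderConjugate.two_two
            (f := fun y => ‖fderiv ℝ φ y‖ₑ) (g := fun y => ‖u y‖ₑ) (by fun_prop) (by fun_prop)
          simpa [eLpNorm_eq_lintegral_rpow_enorm_toReal] using h
  · exact ((hdφ.clm_apply continuous_const).smul hu').integrable_of_hasCompactSupport
      hdφe.smul_right
  · exact (hφ'.smul (hdu.clm_apply continuous_const)).integrable_of_hasCompactSupport
      hφc.smul_right
  · exact (hφ'.smul hu').integrable_of_hasCompactSupport hφc.smul_right
  · exact fun y _ => hφ.differentiable one_ne_zero y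
  · exact fun y _ => hu.differentiable one_ne_zero y

theorem setLIntegral_enorm_sub_apply_zero_le [CompleteSpace F] {f : E → F} (hf : ContDiff ℝ 1 f)
    {p : ENNReal} (hp : 1 ≤ p) :
    ∫⁻ y in Metric.ball 0 1, ‖f y - f 0‖ₑ ∂μ
      ≤ (∫⁻ t in Set.Ioc (0 : ℝ) 1, ENNReal.ofReal (t ^ (-(Module.finrank ℝ E / p.toReal))))
        * (eLpNorm (fderiv ℝ f) p μ * μ (Metric.ball 0 1) ^ (1 - 1 / p.toReal)) := by
  have hdf : Continuous (fderiv ℝ f) := hf.continuous_fderiv one_ne_zero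
  calc ∫⁻ y in Metric.ball 0 1, ‖f y - f 0‖ₑ ∂μ
      ≤ ∫⁻ y in Metric.ball 0 1, (∫⁻ t in Set.Ioc (0 : ℝ) 1, ‖fderiv ℝ f (t • y)‖ₑ) ∂μ := by
        refine setLIntegral_mono' Metric.isOpen_ball.measurableSet fun y hy => ?_
        refine (enorm_sub_apply_zero_le_lintegral_fderiv hf y).trans
          (lintegral_mono fun t => mul_le_of_le_one_right' ?_)
        rw [mem_ball_zero_iff] at hy
        rw [← ofReal_norm]
        exact ENNReal.ofReal_le_one.2 hy.le
    _ = ∫⁻ t in Set.Ioc (0 : ℝ) 1, (∫⁻ y in Metric.ball 0 1, ‖fderiv ℝ f (t • y)‖ₑ ∂μ) := by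
        refine lintegral_lintegral_swap (Continuous.aemeasurable ?_)
        exact (hdf.comp (continuous_snd.smul continuous_fst)).enorm
    _ ≤ ∫⁻ t in Set.Ioc (0 : ℝ) 1, ENNReal.ofReal (t ^ (-(Module.finrank ℝ E / p.toReal)))
          * (eLpNorm (fderiv ℝ f) p μ * μ (Metric.ball 0 1) ^ (1 - 1 / p.toReal)) := by
        refine setLIntegral_mono' measurableSet_Ioc fun t ht => ?_
        rw [← mul_assoc]
        exact setLIntegral_enorm_comp_smul_le μ hdf hp _ ht.1
    _ = _ := lintegral_mul_const _ (by fun_prop)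

theorem enorm_apply_zero_le_add_setLIntegral {X : Type*} [NormedAddCommGroup X]
    [MeasurableSpace X] [BorelSpace X] (μ : Measure X) [IsFiniteMeasureOnCompacts μ]
    [CompleteSpace F] {φ : X → ℝ} (hφ : Continuous φ) (hφc : HasCompactSupport φ)
    (hφ1 : ∫ y, φ y ∂μ = 1) {s : Set X} (hs : Function.support φ ⊆ s)
    {M : ENNReal} (hM : ∀ y, ‖φ y‖ₑ ≤ M) {f : X → F} (hf : Continuous f) :
    ‖f 0‖ₑ ≤ ‖∫ y, φ y • f y ∂μ‖ₑ + M * ∫⁻ y in s, ‖f y - f 0‖ₑ ∂μ := by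
  have hint1 : Integrable (fun y => φ y • f y) μ :=
    (hφ.smul hf).integrable_of_hasCompactSupport hφc.smul_right
  have hint2 : Integrable (fun y => φ y • f 0) μ :=
    (hφ.smul continuous_const).integrable_of_hasCompactSupport hφc.smul_right
  have hf0 : f 0 = (∫ y, φ y • f y ∂μ) - ∫ y, φ y • (f y - f 0) ∂μ := by
    simp only [smul_sub]
    rw [integral_sub hint1 hint2, integral_smul_const, hφ1]
    simp
  calc ‖f 0‖ₑ ≤ ‖∫ y, φ y • f y ∂μ‖ₑ + ‖∫ y, φ y • (f y - f 0) ∂μ‖ₑ := by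
        conv_lhs => rw [hf0]
        exact enorm_sub_le
    _ ≤ _ := by
        gcongr
        have hmeas : Measurable fun y => ‖f y - f 0‖ₑ :=
          (hf.sub continuous_const).enorm.measurable
        rw [← setIntegral_eq_integral_of_forall_compl_eq_zero (s := s) fun y hy => by
          rw [Function.notMem_support.1 fun h => hy (hs h), zero_smul]]
        refine (enorm_integral_le_lintegral_enorm _).trans ?_
        rw [← lintegral_const_mul _ hmeas]
        refine lintegral_mono fun y => ?_
        rw [enorm_smul]
        gcongr
        exact hM y

end

theorem setLIntegral_ofReal_rpow_neg_lt_top {a : ℝ} (ha : a < 1) :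
    ∫⁻ t in Set.Ioc (0 : ℝ) 1, ENNReal.ofReal (t ^ (-a)) < ⊤ := by
  have h : IntervalIntegrable (fun t : ℝ => t ^ (-a)) volume 0 1 :=
    intervalIntegral.intervalIntegrable_rpow' (by linarith)
  rw [intervalIntegrable_iff_integrableOn_Ioc_of_le zero_le_one] at h
  exact (lintegral_mono fun t => Real.ofReal_le_enorm _).trans_lt h.2

/-- There is `C > 0` such that for all `p > 4` and all Schwartz
`u : ℝ³ → ℝ³`, `‖Du‖_{L^∞} ≤ C (‖u‖_{L²} + ‖D²u‖_{L^p})`, with `C` independent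
of `p`. -/
theorem bernstein_interpolation_uniform_const :
    ∃ C : ℝ, 0 < C ∧ ∀ p : ℝ, 4 < p →
      ∀ u : SchwartzMap (EuclideanSpace ℝ (Fin 3)) (EuclideanSpace ℝ (Fin 3)),
        eLpNorm (fun x => fderiv ℝ (⇑u) x) ⊤ volume
          ≤ ENNReal.ofReal C
              * (eLpNorm (⇑u) 2 volume
                  + eLpNorm (fun x => fderiv ℝ (fderiv ℝ (⇑u)) x)
                      (ENNReal.ofReal p) volume) := by
  let ψ : ContDiffBump (0 : EuclideanSpace ℝ (Fin 3)) := ⟨1 / 2, 1, by norm_num, by norm_num⟩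
  set φ := ψ.normed volume with hφdef
  have hφ : ContDiff ℝ 1 φ := ψ.contDiff_normed (n := 1)
  have hφc : HasCompactSupport φ := ψ.hasCompactSupport_normed
  have hφs : Function.support φ ⊆ Metric.ball 0 1 := ψ.support_normed_eq.subset
  obtain ⟨S, hS⟩ := hφ.continuous.bounded_above_of_compact_support hφc
  have hM : ∀ y, ‖φ y‖ₑ ≤ ENNReal.ofReal S := fun y => by
    rw [← ofReal_norm]
    exact ENNReal.ofReal_le_ofReal (hS y)
  set A := eLpNorm (fderiv ℝ φ) 2 volume with hA
  have hAtop : A ≠ ⊤ :=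
    ((hφ.continuous_fderiv one_ne_zero).memLp_of_hasCompactSupport (hφc.fderiv ℝ)).2.ne
  set T := ∫⁻ t in Set.Ioc (0 : ℝ) 1, ENNReal.ofReal (t ^ (-(3 / 4 : ℝ))) with hT
  have hTtop : T ≠ ⊤ := (setLIntegral_ofReal_rpow_neg_lt_top (by norm_num)).ne
  set V := max 1 (volume (Metric.ball (0 : EuclideanSpace ℝ (Fin 3)) 1)) with hV
  have hVtop : V ≠ ⊤ := by simp [hV]
  set K := A + ENNReal.ofReal S * (T * V) with hK
  have hKtop : K ≠ ⊤ := by finiteness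
  refine ⟨K.toReal + 1, by positivity, fun p hp u => ?_⟩
  have hpos : (0 : ℝ) < p := by linarith
  have hp1 : (1 : ENNReal) ≤ ENNReal.ofReal p := ENNReal.one_le_ofReal.2 (by linarith)
  have hKC : K ≤ ENNReal.ofReal (K.toReal + 1) := by
    conv_lhs => rw [← ENNReal.ofReal_toReal hKtop]
    exact ENNReal.ofReal_le_ofReal (by linarith)
  rw [eLpNorm_exponent_top]
  refine eLpNormEssSup_le_of_ae_enorm_bound (Filter.Eventually.of_forall fun x => ?_)
  have htrans {G : Type} [NormedAddCommGroup G] (g : EuclideanSpace ℝ (Fin 3) → G)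
      (hg : Continuous g) (q : ENNReal) :
      eLpNorm (fun y => g (y + x)) q volume = eLpNorm g q volume :=
    eLpNorm_comp_measurePreserving (p := q) hg.aestronglyMeasurable
      (measurePreserving_add_right volume x)
  set v : EuclideanSpace ℝ (Fin 3) → EuclideanSpace ℝ (Fin 3) := fun y => u (y + x) with hv
  have hv2 : ContDiff ℝ 2 v := (u.smooth 2).comp (contDiff_id.add contDiff_const)
  have hdv : fderiv ℝ v = fun y => fderiv ℝ u (y + x) := by
    funext y; exact fderiv_comp_add_right x
  have hddv : fderiv ℝ (fderiv ℝ v) = fun y => fderiv ℝ (fderiv ℝ u) (y + x) := by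
    rw [hdv]; funext y; exact fderiv_comp_add_right (f := fderiv ℝ u) x
  have hdv1 : ContDiff ℝ 1 (fderiv ℝ v) := hv2.fderiv_right (by norm_num)
  have hdu1 : ContDiff ℝ 1 (fderiv ℝ u) := (u.smooth 2).fderiv_right (by norm_num)
  have hx : fderiv ℝ u x = fderiv ℝ v 0 := by simp [hdv]
  have hTp : ∫⁻ t in Set.Ioc (0 : ℝ) 1, ENNReal.ofReal
      (t ^ (-(Module.finrank ℝ (EuclideanSpace ℝ (Fin 3)) / (ENNReal.ofReal p).toReal))) ≤ T := by
    refine setLIntegral_mono' measurableSet_Ioc fun t ht => ENNReal.ofReal_le_ofReal ?_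
    refine Real.rpow_le_rpow_of_exponent_ge ht.1 ht.2 ?_
    rw [finrank_euclideanSpace_fin, ENNReal.toReal_ofReal hpos.le, neg_le_neg_iff]
    push_cast
    gcongr
  have hVp : volume (Metric.ball (0 : EuclideanSpace ℝ (Fin 3)) 1)
      ^ (1 - 1 / (ENNReal.ofReal p).toReal) ≤ V := by
    rw [ENNReal.toReal_ofReal hpos.le]
    have h1 : 1 / p ≤ 1 := (div_le_one hpos).2 (by linarith)
    have h2 : 0 ≤ 1 / p := by positivity
    calc _ ≤ V ^ (1 - 1 / p) := ENNReal.rpow_le_rpow (le_max_right _ _) (by linarith)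
      _ ≤ V ^ (1 : ℝ) := ENNReal.rpow_le_rpow_of_exponent_le (le_max_left _ _) (by linarith)
      _ = V := ENNReal.rpow_one V
  have hL2 : eLpNorm v 2 volume = eLpNorm u 2 volume := htrans u u.continuous 2
  have hLp : eLpNorm (fderiv ℝ (fderiv ℝ v)) (ENNReal.ofReal p) volume
      = eLpNorm (fderiv ℝ (fderiv ℝ u)) (ENNReal.ofReal p) volume := by
    rw [hddv]
    exact htrans _ (hdu1.continuous_fderiv one_ne_zero) _
  set N := eLpNorm (fderiv ℝ (fderiv ℝ u)) (ENNReal.ofReal p) volume with hN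
  calc ‖fderiv ℝ u x‖ₑ = ‖fderiv ℝ v 0‖ₑ := by rw [hx]
    _ ≤ ‖∫ y, φ y • fderiv ℝ v y‖ₑ
        + ENNReal.ofReal S * ∫⁻ y in Metric.ball 0 1, ‖fderiv ℝ v y - fderiv ℝ v 0‖ₑ :=
        enorm_apply_zero_le_add_setLIntegral volume hφ.continuous hφc ψ.integral_normed hφs hM
          hdv1.continuous
    _ ≤ A * eLpNorm u 2 volume + ENNReal.ofReal S * (T * (N * V)) := by
        gcongr
        · rw [← hL2]
          exact enorm_integral_smul_fderiv_le volume hφ hφc (hv2.of_le (by norm_num))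
        · refine (setLIntegral_enorm_sub_apply_zero_le volume hdv1 hp1).trans ?_
          rw [hLp]
          gcongr
    _ = A * eLpNorm u 2 volume + ENNReal.ofReal S * (T * V) * N := by ring
    _ ≤ K * eLpNorm u 2 volume + K * N := by
        gcongr
        · exact le_self_add
        · exact le_add_self
    _ = K * (eLpNorm u 2 volume + N) := (mul_add _ _ _).symm
    _ ≤ _ := by gcongr
end

section
/- Let C ≥ 1, let 0 < T* ≤ 1, and let g : [0, T*) → ℝ be a function such that for every real p > 4 and every t ∈ [0, T*), g(t) ≥ (C · p^{2(1+α(p))} · (T* − t))^{−1/α(p)} − p^{2(γ(p)−1)}, where α(p) = 5/(7 − 6/p) and γ(p) = (7p − 3)/(2p + 3). Then there exists a constant C' > 0, depending only on C, such that g(t) ≥ 1 / ( C' · (T* − t)^{7/5} · (log(1/(T* − t)))^{24/5} ) for all t ∈ [0, T*) with T* − t < 1/C'. -/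
open Set Filter

/-- With `p = L = log (1 / s)`, the main term of the lower bound is at least
`C^{-7/5} e^{-6/5} s^{-7/5} L^{-24/5}`. -/
theorem main_term_lower_bound {C L : ℝ} (hC : 1 ≤ C) (hL : 4 < L) :
    Real.exp (-(7 / 5) * Real.log C - 6 / 5) * (Real.exp (7 / 5 * L) / L ^ ((24:ℝ) / 5)) ≤
      (C * L ^ (2 * (1 + 5 / (7 - 6 / L))) * Real.exp (-L)) ^ (-(1 / (5 / (7 - 6 / L)))) := by
  have hL0 : 0 < L := by linarith
  have hC0 : 0 < C := by linarith
  have hlogC : 0 ≤ Real.log C := Real.log_nonneg hC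
  have hlogL : 0 ≤ Real.log L := Real.log_nonneg (by linarith)
  have hdiv : 0 < 6 / L := by positivity
  have hdiv' : 6 / L < 6 / 4 := by gcongr
  set k : ℝ := 7 - 6 / L with hk
  have hk0 : 0 < k := by linarith
  have hkL : k * L = 7 * L - 6 := by rw [hk]; field_simp
  have hbase : C * L ^ (2 * (1 + 5 / k)) * Real.exp (-L)
      = Real.exp (Real.log C + Real.log L * (2 * (1 + 5 / k)) + -L) := by
    rw [Real.exp_add, Real.exp_add, Real.exp_log hC0, Real.rpow_def_of_pos hL0]
  rw [hbase, ← Real.exp_mul, Real.rpow_def_of_pos hL0, ← Real.exp_sub, ← Real.exp_add,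
    Real.exp_le_exp]
  have hexp : (Real.log C + Real.log L * (2 * (1 + 5 / k)) + -L) * -(1 / (5 / k))
      = -(k / 5) * Real.log C - 2 * (k / 5 + 1) * Real.log L + k * L / 5 := by
    field_simp
    ring
  rw [hexp, hkL]
  have h₁ : 0 ≤ (7 - k) * Real.log C := mul_nonneg (by linarith) hlogC
  have h₂ : 0 ≤ (7 - k) * Real.log L := mul_nonneg (by linarith) hlogL
  linarith

/-- The subtracted term is at most `p ^ 5`. -/
theorem error_term_upper_bound {p : ℝ} (hp : 1 ≤ p) :
    p ^ (2 * ((7 * p - 3) / (2 * p + 3) - 1)) ≤ p ^ (5:ℝ) := by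
  apply Real.rpow_le_rpow_of_exponent_le hp
  have h : (7 * p - 3) / (2 * p + 3) ≤ 7 / 2 := by
    rw [div_le_div_iff₀ (by linarith) (by norm_num)]
    linarith
  linarith

/-- Eventually `L ^ 5` is at most any fixed positive multiple of `e^{7L/5} L^{-24/5}`. -/
theorem eventually_rpow_five_le {A : ℝ} (hA : 0 < A) :
    ∀ᶠ L : ℝ in atTop, L ^ (5:ℝ) ≤ A * (Real.exp (7 / 5 * L) / L ^ ((24:ℝ) / 5)) := by
  have h := tendsto_exp_mul_div_rpow_atTop (5 + 24 / 5) (7 / 5) (by norm_num)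
  filter_upwards [h.eventually_ge_atTop (1 / A), eventually_gt_atTop 0] with L hL hL0
  rw [Real.rpow_add hL0, ← div_div, div_right_comm, le_div_iff₀ (by positivity),
    div_mul_eq_mul_div, one_mul, div_le_iff₀ hA] at hL
  linarith

/-- Optimization in `p` of the family of lower bounds
`g t ≥ (C p^{2(1+α(p))} (T*-t))^{-1/α(p)} - p^{2(γ(p)-1)}`, with
`α(p) = 5/(7-6/p)` and `γ(p) = (7p-3)/(2p+3)`: there is a constant `C' > 0`
depending only on `C` so that
`g t ≥ 1 / (C' (T*-t)^{7/5} (log(1/(T*-t)))^{24/5})` for `T* - t < 1/C'`. -/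
theorem optimization_in_p (C : ℝ) (hC : 1 ≤ C) :
    ∃ C' : ℝ, 0 < C' ∧
      ∀ T : ℝ, 0 < T → T ≤ 1 → ∀ g : ℝ → ℝ,
        (∀ p : ℝ, 4 < p → ∀ t ∈ Set.Ico (0:ℝ) T,
          (C * p ^ (2 * (1 + 5 / (7 - 6 / p))) * (T - t))
              ^ (-(1 / (5 / (7 - 6 / p))))
            - p ^ (2 * ((7 * p - 3) / (2 * p + 3) - 1)) ≤ g t) →
        ∀ t ∈ Set.Ico (0:ℝ) T, T - t < 1 / C' →
          1 / (C' * (T - t) ^ ((7:ℝ) / 5)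
                * (Real.log (1 / (T - t))) ^ ((24:ℝ) / 5)) ≤ g t := by
  set A : ℝ := Real.exp (-(7 / 5) * Real.log C - 6 / 5) with hA
  have hA0 : 0 < A := Real.exp_pos _
  obtain ⟨L₀, hL₀⟩ := eventually_atTop.1
    ((eventually_rpow_five_le (half_pos hA0)).and (eventually_gt_atTop 4))
  refine ⟨max (2 / A) (Real.exp L₀), lt_max_of_lt_right (Real.exp_pos _), ?_⟩
  intro T _ _ g hg t ht hs
  set C' : ℝ := max (2 / A) (Real.exp L₀) with hC'
  have hC'0 : 0 < C' := lt_max_of_lt_right (Real.exp_pos _)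
  have hs0 : 0 < T - t := sub_pos.2 ht.2
  set L : ℝ := Real.log (1 / (T - t)) with hL
  have hsL : T - t = Real.exp (-L) := by
    rw [hL, one_div, Real.log_inv, neg_neg, Real.exp_log hs0]
  have hLL₀ : L₀ ≤ L := by
    rw [hL, Real.le_log_iff_exp_le (by positivity)]
    exact (le_max_right _ _).trans ((lt_one_div hs0 hC'0).1 hs).le
  obtain ⟨h_err, hL4⟩ := hL₀ L hLL₀
  have h_main := main_term_lower_bound hC hL4
  have h_err' := error_term_upper_bound (p := L) (by linarith)
  have h_g := hg L hL4 t ht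
  rw [hsL] at h_g ⊢
  set M : ℝ := Real.exp (7 / 5 * L) / L ^ ((24:ℝ) / 5) with hM
  have hL0 : 0 < L := by linarith
  have hM0 : 0 < M := by positivity
  have h_eq : 1 / (C' * Real.exp (-L) ^ ((7:ℝ) / 5) * L ^ ((24:ℝ) / 5)) = 1 / C' * M := by
    rw [hM, ← Real.exp_mul, neg_mul, mul_comm L, Real.exp_neg]
    field_simp
  have h_inv : 1 / C' ≤ A / 2 := by
    rw [one_div_le hC'0 (by positivity), one_div_div]
    exact le_max_left _ _
  rw [h_eq]
  have := mul_le_mul_of_nonneg_right h_inv hM0.le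
  linarith
end
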